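/- In any execution of the AGS coding scheme Π (Algorithms 3–4) on inputs (x,y) with an arbitrary erasure pattern, for every round i > t_A: r_A(i) = r_B(i) = N/2, T^A(i) = T^B(i), and Bob remains silent (sends □) in round i. -/

import Mathlib

/-!
Model of the AGS coding scheme Π (Algorithms 3–4) of "Interactive coding resilient to
an unknown number of erasures".  A noiseless alternating binary protocol `π` of length
`N` is given by next-bit functions `fA fB : List Bool → Bool` (`fA t = π(x∣t)` on
even-length transcripts, `fB t = π(y∣t)` on odd-length transcripts).
Rounds are 1-indexed; round `i` consists of two timesteps whose erasures are given by
`(E i).1` (odd timestep, Alice → Bob) and `(E i).2` (even timestep, Bob → Alice).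
In each timestep the sender either transmits a symbol `(b, ρ) ∈ {0,1}×{0,1}` or stays
silent (`□`); a reception is `none` (= the erasure mark ⊥) or `some` of a symbol.
-/

namespace AGS

/-- A transmitted symbol: a message `(bit, parity)`, or silence `□`. -/
inductive Sym where
  | msg : Bool → Bool → Sym
  | sil : Sym
deriving DecidableEq

/-- The word (information-bit content) of a symbol: one bit for a message, the empty
word for silence. -/
def symWord : Sym → List Bool
  | Sym.msg b _ => [b]
  | Sym.sil => []

/-- Parity of a round number, as a Boolean. -/
def par (r : ℕ) : Bool := decide (r % 2 = 1)

/-- Joint state at the beginning of a round: Alice's transcript `TA`, counter `rA`,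
flag `abot` (her last reception was ⊥); Bob's transcript `TB`, counter `rB`, and
stored bit `bsend`. -/
structure St where
  TA : List Bool
  rA : ℕ
  abot : Bool
  TB : List Bool
  rB : ℕ
  bsend : Bool
deriving DecidableEq

/-- The initial state. -/
def init : St := ⟨[], 0, false, [], 0, false⟩

/-- The symbol Alice sends in the odd timestep of a round (silence if her last
reception was erased, and implicit silence after she has terminated). -/
def sentA (fA : List Bool → Bool) (N : ℕ) (s : St) : Sym :=
  if s.rA < N / 2 then
    if s.abot then Sym.sil else Sym.msg (fA s.TA) (par (s.rA + 1))
  else Sym.sil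

/-- Bob's reception in the odd timestep (`none` = erasure mark ⊥). -/
def recvB (fA : List Bool → Bool) (N : ℕ) (e1 : Bool) (s : St) : Option Sym :=
  if e1 then none else some (sentA fA N s)

/-- Bob's update of `TB, rB, bsend` in the odd timestep, given his reception. -/
def bobUpd (fB : List Bool → Bool) (N : ℕ) (r : Option Sym) (s : St) : St :=
  if s.rB < N / 2 then
    match r with
    | some (Sym.msg b p) =>
        if p = par (s.rB + 1) then
          { s with rB := s.rB + 1, bsend := fB (s.TB ++ [b]),
                   TB := (s.TB ++ [b]) ++ [fB (s.TB ++ [b])] }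
        else s
    | _ => s
  else s

/-- The symbol Bob sends in the even timestep of a round, given the erasure `e1` of
the odd timestep and the state `s` at the beginning of the round.  In the normal
phase (`rB < N/2`) he answers any non-⊥ reception with his (possibly just updated)
stored message and is silent upon ⊥; in the termination phase (`rB = N/2`) he answers
only a non-silent message of matching parity, and is silent otherwise. -/
def sentB (fA fB : List Bool → Bool) (N : ℕ) (e1 : Bool) (s : St) : Sym :=
  let r := recvB fA N e1 s
  if s.rB < N / 2 then
    match r with
    | none => Sym.sil
    | some _ =>
        let s' := bobUpd fB N r s
        Sym.msg s'.bsend (par s'.rB)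
  else
    match r with
    | some (Sym.msg _ p) => if p = par s.rB then Sym.msg s.bsend (par s.rB) else Sym.sil
    | _ => Sym.sil

/-- One round of the AGS coding scheme.  After Alice terminates (`rA = N/2`) her part
of the state is frozen and only Bob's part evolves (he keeps receiving silence, unless
erased). -/
def step (fA fB : List Bool → Bool) (N : ℕ) (e : Bool × Bool) (s : St) : St :=
  let r := recvB fA N e.1 s
  let sB := bobUpd fB N r s
  if s.rA < N / 2 then
    let mB := sentB fA fB N e.1 s
    let rcvA : Option Sym := if e.2 then none else some mB
    match rcvA with
    | none => { sB with rA := s.rA, abot := true }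
    | some (Sym.msg b p) =>
        if p = par (s.rA + 1) then
          { sB with TA := (s.TA ++ [fA s.TA]) ++ [b], rA := s.rA + 1, abot := false }
        else { sB with rA := s.rA, abot := false }
    | some Sym.sil => { sB with rA := s.rA, abot := false }
  else sB

/-- `exec fA fB N E k` is the state after `k` rounds have been played. -/
def exec (fA fB : List Bool → Bool) (N : ℕ) (E : ℕ → Bool × Bool) : ℕ → St
  | 0 => init
  | k + 1 => step fA fB N (E (k + 1)) (exec fA fB N E k)

/-- `stAt fA fB N E i` is the state at the beginning of round `i` (rounds 1-indexed):
for a protocol variable `v`, `v(i) = (stAt … i).v`. -/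
def stAt (fA fB : List Bool → Bool) (N : ℕ) (E : ℕ → Bool × Bool) (i : ℕ) : St :=
  exec fA fB N E (i - 1)

/-- The noiseless transcript of `π` after `r` rounds; `transcript fA fB (N/2)` is `T^π`. -/
def transcript (fA fB : List Bool → Bool) : ℕ → List Bool
  | 0 => []
  | r + 1 =>
    let t := transcript fA fB r
    (t ++ [fA t]) ++ [fB (t ++ [fA t])]

/-- `cA … i` : the number of rounds `j < i` in which Alice sent a non-silent message. -/
def cA (fA fB : List Bool → Bool) (N : ℕ) (E : ℕ → Bool × Bool) (i : ℕ) : ℕ :=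
  ((Finset.Ico 1 i).filter fun j => sentA fA N (stAt fA fB N E j) ≠ Sym.sil).card

/-- `cB … i` : the number of rounds `j < i` in which Bob sent a non-silent message. -/
def cB (fA fB : List Bool → Bool) (N : ℕ) (E : ℕ → Bool × Bool) (i : ℕ) : ℕ :=
  ((Finset.Ico 1 i).filter fun j =>
    sentB fA fB N (E j).1 (stAt fA fB N E j) ≠ Sym.sil).card

/-- `cch … i` : the total number of ⊥ receptions of Bob and of Alice in the rounds
before round `i` (Alice receives only while she is active). -/
def cch (fA fB : List Bool → Bool) (N : ℕ) (E : ℕ → Bool × Bool) (i : ℕ) : ℕ :=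
  ((Finset.Ico 1 i).filter fun j => (E j).1 = true).card +
  ((Finset.Ico 1 i).filter fun j =>
    (E j).2 = true ∧ (stAt fA fB N E j).rA < N / 2).card

theorem par_succ_ne (r : ℕ) : par r ≠ par (r + 1) := by
  simp only [par, ne_eq, decide_eq_decide]
  omega

/-- At the beginning of every round, either both parties agree on their counters and
transcripts, or Bob is exactly one round ahead and his stored bit is the last bit of
his transcript. -/
def Sync (fA : List Bool → Bool) (N : ℕ) (s : St) : Prop :=
  (s.rA ≤ N / 2 ∧ s.rB = s.rA ∧ s.TB = s.TA) ∨
  (s.rA < N / 2 ∧ s.rB = s.rA + 1 ∧ s.TB = (s.TA ++ [fA s.TA]) ++ [s.bsend])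

theorem Sync.step {fA fB : List Bool → Bool} {N : ℕ} {s : St} (h : Sync fA N s)
    (e : Bool × Bool) : Sync fA N (step fA fB N e s) := by
  obtain ⟨TA, rA, abot, TB, rB, bsend⟩ := s
  obtain ⟨e₁, e₂⟩ := e
  have p₁ := par_succ_ne rA
  have p₂ := par_succ_ne (rA + 1)
  obtain ⟨hle, hr, hT⟩ | ⟨hlt, hr, hT⟩ := h
  · dsimp only at hle hr hT
    subst hr hT
    by_cases hlt : rB < N / 2
    · cases e₁ <;> cases e₂ <;> cases abot <;>
        simp [AGS.step, recvB, sentA, sentB, bobUpd, Sync, hlt, p₁] <;> omega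
    · simp [AGS.step, bobUpd, Sync, hlt, hle]
  · dsimp only at hlt hr hT
    subst hr hT
    by_cases hlt' : rA + 1 < N / 2 <;>
      cases e₁ <;> cases e₂ <;> cases abot <;>
        simp [AGS.step, recvB, sentA, sentB, bobUpd, Sync, hlt, hlt', p₂]

theorem sync_exec (fA fB : List Bool → Bool) (N : ℕ) (E : ℕ → Bool × Bool) (k : ℕ) :
    Sync fA N (exec fA fB N E k) := by
  induction k with
  | zero => simp [exec, init, Sync]
  | succ k ih => exact ih.step _

theorem bobUpd_rA (fB : List Bool → Bool) (N : ℕ) (r : Option Sym) (s : St) :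
    (bobUpd fB N r s).rA = s.rA := by
  unfold bobUpd
  split_ifs
  · split
    · split_ifs <;> rfl
    · rfl
  · rfl

theorem exec_rA_of_le {fA fB : List Bool → Bool} {N : ℕ} {E : ℕ → Bool × Bool} {k m : ℕ}
    (hk : (exec fA fB N E k).rA = N / 2) (hkm : k ≤ m) :
    (exec fA fB N E m).rA = N / 2 := by
  induction m, hkm using Nat.le_induction with
  | base => exact hk
  | succ m _ ih => simp [exec, step, ih, bobUpd_rA]

theorem Sync.of_rA_eq {fA : List Bool → Bool} {N : ℕ} {s : St} (h : Sync fA N s)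
    (hA : s.rA = N / 2) : s.rB = N / 2 ∧ s.TA = s.TB := by
  obtain ⟨-, hr, hT⟩ | ⟨hlt, -, -⟩ := h
  · exact ⟨hr.trans hA, hT.symm⟩
  · exact absurd hA hlt.ne

theorem sentB_eq_sil {fA : List Bool → Bool} (fB : List Bool → Bool) {N : ℕ} (e₁ : Bool)
    {s : St} (hA : s.rA = N / 2) (hB : s.rB = N / 2) : sentB fA fB N e₁ s = Sym.sil := by
  cases e₁ <;> simp [sentB, recvB, sentA, hA, hB]

/-- Lemma 14 of the paper.  In any execution of the AGS scheme,
for every round `i > t_A`: `r_A(i) = r_B(i) = N/2`, `T^A(i) = T^B(i)`, and Bob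
remains silent (sends `□`) in round `i`. -/
theorem ags_after_alice_terminates
    (fA fB : List Bool → Bool) (N : ℕ) (hN : 0 < N) (hNeven : Even N)
    (E : ℕ → Bool × Bool) (tA : ℕ)
    (htA1 : ∀ i, 1 ≤ i → i ≤ tA → (stAt fA fB N E i).rA < N / 2)
    (htA2 : (stAt fA fB N E (tA + 1)).rA = N / 2)
    (i : ℕ) (hi : tA < i) :
    (stAt fA fB N E i).rA = N / 2 ∧
    (stAt fA fB N E i).rB = N / 2 ∧
    (stAt fA fB N E i).TA = (stAt fA fB N E i).TB ∧
    sentB fA fB N (E i).1 (stAt fA fB N E i) = Sym.sil := by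
  have hA : (stAt fA fB N E i).rA = N / 2 := exec_rA_of_le htA2 (by omega)
  obtain ⟨hB, hT⟩ := (sync_exec fA fB N E (i - 1)).of_rA_eq hA
  exact ⟨hA, hB, hT, sentB_eq_sil fB _ hA hB⟩

end AGS
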